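/- arXiv:1603.01744 — 2 statements merged into one kernel-verified Lean document; each statement's English description precedes it below -/
import Mathlib

section
/- Let M ≥ 2, d ≥ 2 and let A = (A_1,…,A_M) be an irreducible tuple of d×d real matrices. Suppose there exists λ ∈ ℝ such that for every n ≥ 1 and all x_1,…,x_n ∈ {1,…,M} one has ρ(A_{x_n}⋯A_{x_1}) ∈ {0, e^{λn}} (equivalently, every element of the semigroup generated by e^{−λ}A_1,…,e^{−λ}A_M has spectral radius either 0 or 1). Then there exist a ≥ 0 and b ∈ ℝ such that P(A,s) = a + bs for every s > 0. -/
open MeasureTheory Filter Topology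

/-- The operator norm on square real matrices induced by the Euclidean norm. -/
noncomputable def opNorm {n : Type*} [Fintype n] [DecidableEq n]
    (X : Matrix n n ℝ) : ℝ :=
  ‖Matrix.toEuclideanCLM (𝕜 := ℝ) X‖

/-- The spectral radius `ρ(X) = inf_{k ≥ 1} ‖X^k‖^(1/k)` (Gelfand). -/
noncomputable def specRad {n : Type*} [Fintype n] [DecidableEq n]
    (X : Matrix n n ℝ) : ℝ :=
  ⨅ k : ℕ, opNorm (X ^ (k + 1)) ^ ((1 : ℝ) / (k + 1))

/-- The product `A_{x_n} ⋯ A_{x_1}` associated to the word `x = (x_1, …, x_n)`. -/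
noncomputable def wordProd {M d n : ℕ} (A : Fin M → Matrix (Fin d) (Fin d) ℝ)
    (x : Fin n → Fin M) : Matrix (Fin d) (Fin d) ℝ :=
  (List.ofFn (fun i => A (x i))).reverse.prod

/-- The product `A_{x_n} ⋯ A_{x_1}` associated to the word `w = [x_1, …, x_n]`. -/
noncomputable def listProd {M d : ℕ} (A : Fin M → Matrix (Fin d) (Fin d) ℝ)
    (w : List (Fin M)) : Matrix (Fin d) (Fin d) ℝ :=
  ((w.map A).reverse).prod

/-- Irreducibility: no invariant subspace `U` with `0 < dim U < d`. -/
def IsIrredTuple {M d : ℕ} (A : Fin M → Matrix (Fin d) (Fin d) ℝ) : Prop :=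
  ¬ ∃ U : Submodule ℝ (Fin d → ℝ),
      (∀ i, U.map (A i).mulVecLin ≤ U) ∧ U ≠ ⊥ ∧ U ≠ ⊤

/-- The shift map on `Σ_M = {1,…,M}^ℕ`. -/
def shift {M : ℕ} : (ℕ → Fin M) → (ℕ → Fin M) := fun x n => x (n + 1)

/-- The cylinder set `[x_1 ⋯ x_n]` determined by the word `w = [x_1, …, x_n]`. -/
def cyl {M : ℕ} (w : List (Fin M)) : Set (ℕ → Fin M) :=
  {y | ∀ i : Fin w.length, y (i : ℕ) = w.get i}

/-- The Gibbs inequality for `(A, s)` with constants `C > 0`, `P ∈ ℝ`. -/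
def IsGibbs {M d : ℕ} (A : Fin M → Matrix (Fin d) (Fin d) ℝ) (s C P : ℝ)
    (μ : Measure (ℕ → Fin M)) : Prop :=
  ∀ w : List (Fin M), w ≠ [] →
    C⁻¹ * (μ (cyl w)).toReal ≤ Real.exp (-(w.length : ℝ) * P) * opNorm (listProd A w) ^ s ∧
    Real.exp (-(w.length : ℝ) * P) * opNorm (listProd A w) ^ s ≤ C * (μ (cyl w)).toReal

/-- The pressure `P(A,s) = inf_{n ≥ 1} (1/n) log Σ_{|x| = n} ‖A_{x_n} ⋯ A_{x_1}‖^s ∈ [-∞, ∞)`,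
with the convention that a term is `-∞` when the corresponding sum vanishes. -/
noncomputable def pressure {M d : ℕ} (A : Fin M → Matrix (Fin d) (Fin d) ℝ) (s : ℝ) : EReal :=
  ⨅ n : ℕ,
    if (∑ x : Fin (n + 1) → Fin M, opNorm (wordProd A x) ^ s) = 0 then (⊥ : EReal)
    else ((Real.log (∑ x : Fin (n + 1) → Fin M, opNorm (wordProd A x) ^ s) / (n + 1) : ℝ) : EReal)

open scoped Matrix Matrix.Norms.L2Operator

lemma aux_trace_nondeg {d : ℕ} (X : Matrix (Fin d) (Fin d) ℝ)
    (htr : ∀ k : ℕ, (X ^ (k + 2)).trace = 0) (v : Fin d → ℝ) (hv : v ≠ 0)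
    (hXv : X *ᵥ v = v) : False := by
  have hpow : ∀ k : ℕ, X ^ k *ᵥ v = v := by
    intro k
    induction k with
    | zero => simp
    | succ k ih => rw [pow_succ, ← Matrix.mulVec_mulVec, hXv, ih]
  have heval : ∀ p : Polynomial ℝ, Polynomial.aeval X p *ᵥ v = p.eval 1 • v := by
    intro p
    induction p using Polynomial.induction_on' with
    | add p q hp hq => simp [Matrix.add_mulVec, hp, hq, add_smul]
    | monomial n a =>
      rw [Polynomial.aeval_monomial, ← Algebra.smul_def, Matrix.smul_mulVec, hpow]; simp
  have htrp : ∀ p : Polynomial ℝ, (Polynomial.aeval X (p * Polynomial.X ^ 2)).trace = 0 := by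
    intro p
    induction p using Polynomial.induction_on' with
    | add p q hp hq => simp only [add_mul, map_add, Matrix.trace_add, hp, hq, add_zero]
    | monomial n a =>
      rw [map_mul, map_pow, Polynomial.aeval_X, Polynomial.aeval_monomial, ← Algebra.smul_def,
        smul_mul_assoc, ← pow_add, Matrix.trace_smul, htr, smul_zero]
  have hne : X.charpoly ≠ 0 := X.charpoly_monic.ne_zero
  obtain ⟨q, hq, hnd⟩ := Polynomial.exists_eq_pow_rootMultiplicity_mul_and_not_dvd _ hne 0
  set m := Polynomial.rootMultiplicity 0 X.charpoly
  simp only [map_zero, sub_zero] at hq hnd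
  have hcop : IsCoprime (Polynomial.X ^ (m + 2) : Polynomial ℝ) q :=
    IsCoprime.pow_left ((Polynomial.irreducible_X.coprime_iff_not_dvd).2 hnd)
  obtain ⟨a, b, hab⟩ := hcop
  have hch : Polynomial.aeval X X.charpoly = 0 := Matrix.aeval_self_charpoly X
  have hq1 : q.eval 1 = 0 := by
    have := heval X.charpoly
    rw [hch, Matrix.zero_mulVec] at this
    rcases smul_eq_zero.1 this.symm with h | h
    · rw [hq] at h; simpa using h
    · exact absurd h hv
  have ha1 : a.eval 1 = 1 := by
    have := congrArg (Polynomial.eval 1) hab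
    simpa [hq1] using this
  set e := Polynomial.aeval X (a * Polynomial.X ^ (m + 2)) with he
  have hid : IsIdempotentElem e := by
    have h1 : a * Polynomial.X ^ (m + 2) * (a * Polynomial.X ^ (m + 2))
        = a * Polynomial.X ^ (m + 2) - (a * Polynomial.X ^ 2 * b) * X.charpoly := by
      have : a * Polynomial.X ^ (m + 2) = 1 - b * q := by rw [← hab]; ring
      rw [hq]
      calc _ = a * Polynomial.X ^ (m + 2) * (1 - b * q) := by rw [← this]
        _ = _ := by ring
    unfold IsIdempotentElem
    rw [he, ← map_mul, h1, map_sub, map_mul _ _ X.charpoly, hch, mul_zero, sub_zero]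
  have htre : e.trace = 0 := by
    rw [he, pow_add, ← mul_assoc]; exact htrp _
  have hev : e *ᵥ v = v := by rw [he, heval]; simp [ha1]
  have hid' : IsIdempotentElem (Matrix.toLin' e) := by
    unfold IsIdempotentElem
    rw [Module.End.mul_eq_comp, ← Matrix.toLin'_mul, hid.eq]
  have h0 := LinearMap.IsIdempotentElem.eq_zero_of_trace_eq_zero hid' (by rw [Matrix.trace_toLin'_eq]; exact htre)
  have : Matrix.toLin' e v = 0 := by rw [h0]; rfl
  rw [Matrix.toLin'_apply, hev] at this
  exact hv this

lemma aux_opNorm {d : ℕ} (X : Matrix (Fin d) (Fin d) ℝ) : opNorm X = ‖X‖ := rfl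

lemma aux_eig_le {d : ℕ} (X : Matrix (Fin d) (Fin d) ℝ) (μ : ℂ) (w : Fin d → ℂ) (hw : w ≠ 0)
    (h : X.map (algebraMap ℝ ℂ) *ᵥ w = μ • w) : ‖μ‖ ≤ ‖X‖ := by
  set x : EuclideanSpace ℝ (Fin d) := WithLp.toLp 2 (fun i => (w i).re) with hx
  set y : EuclideanSpace ℝ (Fin d) := WithLp.toLp 2 (fun i => (w i).im) with hy
  have hX := Matrix.l2_opNorm_mulVec X x
  have hY := Matrix.l2_opNorm_mulVec X y
  set Xx := (EuclideanSpace.equiv (Fin d) ℝ).symm (X *ᵥ x)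
  set Xy := (EuclideanSpace.equiv (Fin d) ℝ).symm (X *ᵥ y)
  have e1 : ‖Xx‖ ^ 2 + ‖Xy‖ ^ 2 = ‖μ‖ ^ 2 * (‖x‖ ^ 2 + ‖y‖ ^ 2) := by
    simp only [EuclideanSpace.norm_sq_eq]
    rw [← Finset.sum_add_distrib, ← Finset.sum_add_distrib, Finset.mul_sum]
    refine Finset.sum_congr rfl fun i _ => ?_
    have hi := congrFun h i
    have hre : (X *ᵥ x) i = (μ * w i).re := by
      have := congrArg Complex.re hi
      simp only [Matrix.mulVec, dotProduct, Complex.re_sum, Pi.smul_apply, smul_eq_mul] at this ⊢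
      rw [← this]; simp [hx]
    have him : (X *ᵥ y) i = (μ * w i).im := by
      have := congrArg Complex.im hi
      simp only [Matrix.mulVec, dotProduct, Complex.im_sum, Pi.smul_apply, smul_eq_mul] at this ⊢
      rw [← this]; simp [hy]
    have h1 : Xx i = (X *ᵥ x) i := rfl
    have h2 : Xy i = (X *ᵥ y) i := rfl
    have h3 : x i = (w i).re := rfl
    have h4 : y i = (w i).im := rfl
    rw [h1, h2, h3, h4, hre, him]
    simp only [Real.norm_eq_abs, sq_abs, Complex.sq_norm, Complex.normSq_apply, Complex.mul_re, Complex.mul_im]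
    ring
  have hpos : 0 < ‖x‖ ^ 2 + ‖y‖ ^ 2 := by
    by_contra hcon
    apply hw
    have hx0 : x = 0 := by
      have : ‖x‖ ^ 2 = 0 := by nlinarith [sq_nonneg ‖x‖, sq_nonneg ‖y‖]
      simpa using this
    have hy0 : y = 0 := by
      have : ‖y‖ ^ 2 = 0 := by nlinarith [sq_nonneg ‖x‖, sq_nonneg ‖y‖]
      simpa using this
    funext i
    apply Complex.ext
    · exact congrArg (fun z : EuclideanSpace ℝ (Fin d) => z i) hx0
    · exact congrArg (fun z : EuclideanSpace ℝ (Fin d) => z i) hy0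
  have e2 : ‖μ‖ ^ 2 * (‖x‖ ^ 2 + ‖y‖ ^ 2) ≤ ‖X‖ ^ 2 * (‖x‖ ^ 2 + ‖y‖ ^ 2) := by
    rw [← e1, mul_add, ← mul_pow, ← mul_pow]
    gcongr
  exact le_of_sq_le_sq (le_of_mul_le_mul_right e2 hpos) (norm_nonneg _)

lemma aux_trace_le {d : ℕ} (X : Matrix (Fin d) (Fin d) ℝ) : |X.trace| ≤ d * specRad X := by
  set Z := X.map (algebraMap ℝ ℂ) with hZ
  have hroot : ∀ μ ∈ Z.charpoly.roots, ‖μ‖ ≤ specRad X := by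
    intro μ hμ
    have hμ' := (Polynomial.mem_roots'.1 hμ).2
    have hev : Module.End.HasEigenvalue (Matrix.toLin' Z) μ := by
      rw [Module.End.hasEigenvalue_iff_isRoot_charpoly, Matrix.charpoly_toLin']
      exact hμ'
    obtain ⟨w, hw⟩ := hev.exists_hasEigenvector
    have hw1 : Z *ᵥ w = μ • w := by simpa using hw.apply_eq_smul
    have hpow : ∀ k : ℕ, Z ^ k *ᵥ w = μ ^ k • w := by
      intro k
      induction k with
      | zero => simp
      | succ k ih => rw [pow_succ, ← Matrix.mulVec_mulVec, hw1, Matrix.mulVec_smul, ih, smul_smul, pow_succ']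
    refine le_ciInf fun k => ?_
    have hk : ‖μ ^ (k + 1)‖ ≤ opNorm (X ^ (k + 1)) := by
      refine aux_eig_le _ _ w hw.2 ?_
      rw [← hpow, hZ]
      congr 1
      exact map_pow (algebraMap ℝ ℂ).mapMatrix X (k + 1)
    rw [norm_pow] at hk
    have := Real.rpow_le_rpow (by positivity) hk (z := 1 / ((k : ℝ) + 1)) (by positivity)
    refine le_trans (le_of_eq ?_) this
    rw [← Real.rpow_natCast, ← Real.rpow_mul (norm_nonneg _)]
    push_cast
    rw [mul_one_div_cancel (by positivity), Real.rpow_one]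
  have htr : ((X.trace : ℝ) : ℂ) = Z.charpoly.roots.sum := by
    rw [← Matrix.trace_eq_sum_roots_charpoly]
    simp [hZ, Matrix.trace]
  have hcard : (Multiset.card Z.charpoly.roots : ℝ) ≤ d := by
    have := Polynomial.card_roots' Z.charpoly
    rw [Matrix.charpoly_natDegree_eq_dim, Fintype.card_fin] at this
    exact_mod_cast this
  have hnn : 0 ≤ specRad X :=
    Real.iInf_nonneg fun k => Real.rpow_nonneg (norm_nonneg _) _
  rw [← Real.norm_eq_abs, ← Complex.norm_real, htr]
  calc ‖Z.charpoly.roots.sum‖ ≤ (Z.charpoly.roots.map (‖·‖)).sum := norm_multiset_sum_le _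
    _ ≤ Multiset.card (Z.charpoly.roots.map (‖·‖)) • specRad X :=
        Multiset.sum_le_card_nsmul _ _ (by
          intro r hr
          obtain ⟨μ, hμ, rfl⟩ := Multiset.mem_map.1 hr
          exact hroot μ hμ)
    _ ≤ d * specRad X := by
        rw [Multiset.card_map, nsmul_eq_mul]; gcongr

lemma aux_specRad_le {d : ℕ} (X : Matrix (Fin d) (Fin d) ℝ) : specRad X ≤ ‖X‖ := by
  have : specRad X ≤ _ := ciInf_le ⟨0, by
    rintro _ ⟨k, rfl⟩; exact Real.rpow_nonneg (norm_nonneg _) _⟩ 0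
  simpa [aux_opNorm] using this

lemma aux_nondeg {d : ℕ} (S : Set (Matrix (Fin d) (Fin d) ℝ))
    (hmul : ∀ X ∈ S, ∀ Y ∈ S, X * Y ∈ S)
    (hirr : ∀ U : Submodule ℝ (Fin d → ℝ), (∀ Y ∈ S, U.map Y.mulVecLin ≤ U) → U = ⊥ ∨ U = ⊤)
    (X : Matrix (Fin d) (Fin d) ℝ) (hX : X ∈ Submodule.span ℝ S)
    (h0 : ∀ Y ∈ S, (X * Y).trace = 0) : X = 0 := by
  set W := Submodule.span ℝ S with hW
  have hl : ∀ Y ∈ S, ∀ X ∈ W, Y * X ∈ W := by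
    intro Y hY X hX
    induction hX using Submodule.span_induction with
    | mem x hx => exact Submodule.subset_span (hmul _ hY _ hx)
    | zero => simp
    | add x y _ _ hx hy => rw [mul_add]; exact W.add_mem hx hy
    | smul a x _ hx => rw [mul_smul_comm]; exact W.smul_mem _ hx
  have hmulW : ∀ X ∈ W, ∀ Y ∈ W, X * Y ∈ W := by
    intro X hX Y hY
    induction hX using Submodule.span_induction with
    | mem x hx => exact hl _ hx _ hY
    | zero => simp
    | add x y _ _ hx hy => rw [add_mul]; exact W.add_mem hx hy
    | smul a x _ hx => rw [smul_mul_assoc]; exact W.smul_mem _ hx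
  by_contra hne
  obtain ⟨v, hv⟩ : ∃ v, X *ᵥ v ≠ 0 := by
    by_contra! hcon
    exact hne (Matrix.ext_of_mulVec_single fun i => by rw [hcon, Matrix.zero_mulVec])
  let U : Submodule ℝ (Fin d → ℝ) :=
    { carrier := {u | ∃ Z ∈ W, (∀ Y ∈ S, (Z * Y).trace = 0) ∧ Z *ᵥ v = u}
      add_mem' := by
        rintro _ _ ⟨Z, hZ, hZ0, rfl⟩ ⟨Z', hZ', hZ0', rfl⟩
        exact ⟨Z + Z', W.add_mem hZ hZ', fun Y hY => by
          rw [add_mul, Matrix.trace_add, hZ0 Y hY, hZ0' Y hY, add_zero], Matrix.add_mulVec _ _ _⟩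
      zero_mem' := ⟨0, W.zero_mem, by simp, by simp⟩
      smul_mem' := by
        rintro c _ ⟨Z, hZ, hZ0, rfl⟩
        exact ⟨c • Z, W.smul_mem c hZ, fun Y hY => by
          rw [smul_mul_assoc, Matrix.trace_smul, hZ0 Y hY, smul_zero], Matrix.smul_mulVec _ _ _⟩ }
  have hU : U = ⊥ ∨ U = ⊤ := by
    refine hirr U ?_
    rintro Y hY _ ⟨_, ⟨Z, hZ, hZ0, rfl⟩, rfl⟩
    refine ⟨Y * Z, hl _ hY _ hZ, fun Y' hY' => ?_, ?_⟩
    · rw [mul_assoc, Matrix.trace_mul_comm, mul_assoc]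
      exact hZ0 _ (hmul _ hY' _ hY)
    · simp [Matrix.mulVec_mulVec]
  have hXU : X *ᵥ v ∈ U := ⟨X, hX, h0, rfl⟩
  rcases hU with hU | hU
  · rw [hU] at hXU; exact hv hXU
  · have hvU : v ∈ U := by rw [hU]; trivial
    obtain ⟨Z, hZ, hZ0, hZv⟩ := hvU
    refine aux_trace_nondeg Z ?_ v (fun h => hv (by rw [h]; simp)) hZv
    have hZW : ∀ Y ∈ W, (Z * Y).trace = 0 := by
      intro Y hY
      induction hY using Submodule.span_induction with
      | mem x hx => exact hZ0 x hx
      | zero => simp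
      | add x y _ _ hx hy => rw [mul_add, Matrix.trace_add, hx, hy, add_zero]
      | smul a x _ hx => rw [mul_smul_comm, Matrix.trace_smul, hx, smul_zero]
    have hp : ∀ k : ℕ, Z ^ (k + 1) ∈ W := by
      intro k
      induction k with
      | zero => simpa using hZ
      | succ k ih => rw [pow_succ]; exact hmulW _ ih _ hZ
    intro k
    rw [show k + 2 = (k + 1) + 1 from rfl, pow_succ']
    exact hZW _ (hp k)

lemma aux_bdd {d : ℕ} (S : Set (Matrix (Fin d) (Fin d) ℝ))
    (hmul : ∀ X ∈ S, ∀ Y ∈ S, X * Y ∈ S)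
    (hirr : ∀ U : Submodule ℝ (Fin d → ℝ), (∀ Y ∈ S, U.map Y.mulVecLin ≤ U) → U = ⊥ ∨ U = ⊤)
    (D : ℝ) (hD : ∀ X ∈ S, |X.trace| ≤ D) (h1 : ∀ X ∈ S, X.trace ≠ 0 → 1 ≤ ‖X‖) :
    ∃ C : ℝ, 0 < C ∧ ∀ X ∈ S, ‖X‖ ≤ C ∧ (X ≠ 0 → C⁻¹ ≤ ‖X‖) := by
  have hnd := aux_nondeg S hmul hirr
  obtain ⟨T, hTS, -, hTspan, -⟩ := Submodule.exists_finset_span_eq_linearIndepOn ℝ S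
  let L : Submodule.span ℝ S →ₗ[ℝ] (T → ℝ) :=
    { toFun := fun X Y => ((X : Matrix (Fin d) (Fin d) ℝ) * (Y : Matrix (Fin d) (Fin d) ℝ)).trace
      map_add' := fun X X' => by funext Y; simp [add_mul]
      map_smul' := fun c X => by funext Y; simp }
  have hL : LinearMap.ker L = ⊥ := by
    rw [LinearMap.ker_eq_bot']
    intro X hX
    apply Subtype.ext
    refine hnd X X.2 fun Y hY => ?_
    have hY' : Y ∈ Submodule.span ℝ (T : Set (Matrix (Fin d) (Fin d) ℝ)) := by
      rw [hTspan]; exact Submodule.subset_span hY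
    clear hY
    induction hY' using Submodule.span_induction with
    | mem x hx => exact congrFun hX ⟨x, hx⟩
    | zero => simp
    | add x y _ _ hx hy => rw [mul_add, Matrix.trace_add, hx, hy, add_zero]
    | smul a x _ hx => rw [mul_smul_comm, Matrix.trace_smul, hx, smul_zero]
  obtain ⟨K, K0, hK⟩ := LinearMap.exists_antilipschitzWith L hL
  have hup : ∀ X ∈ S, ‖X‖ ≤ K * |D| := by
    intro X hX
    have h := hK.le_mul_dist ⟨X, Submodule.subset_span hX⟩ 0
    rw [map_zero, dist_zero_right, dist_zero_right] at h
    refine le_trans h ?_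
    gcongr
    refine (pi_norm_le_iff_of_nonneg (abs_nonneg D)).2 fun Y => ?_
    exact (hD _ (hmul _ hX _ (hTS Y.2))).trans (le_abs_self D)
  refine ⟨K * |D| + 1, by positivity, fun X hX => ⟨(hup X hX).trans (by linarith), fun hne => ?_⟩⟩
  have : ∃ Y ∈ S, (X * Y).trace ≠ 0 := by
    by_contra! hcon
    exact hne (hnd X (Submodule.subset_span hX) hcon)
  obtain ⟨Y, hY, htr⟩ := this
  have h2 := h1 _ (hmul _ hX _ hY) htr
  have h3 : ‖X * Y‖ ≤ ‖X‖ * ‖Y‖ := norm_mul_le X Y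
  have h4 := hup Y hY
  have hC : 0 < (K : ℝ) * |D| + 1 := by positivity
  rw [inv_le_iff_one_le_mul₀ hC]
  nlinarith [norm_nonneg X]

lemma aux_wordProd_append {M d m n : ℕ} (A : Fin M → Matrix (Fin d) (Fin d) ℝ)
    (x : Fin m → Fin M) (y : Fin n → Fin M) :
    wordProd A (Fin.append x y) = wordProd A y * wordProd A x := by
  unfold wordProd
  have : (fun i => A (Fin.append x y i)) = Fin.append (fun i => A (x i)) (fun i => A (y i)) := by
    funext i
    refine Fin.addCases (fun i => ?_) (fun i => ?_) i <;> simp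
  rw [this, List.ofFn_fin_append, List.reverse_append, List.prod_append]

lemma aux_submul {M d : ℕ} (A : Fin M → Matrix (Fin d) (Fin d) ℝ)
    (g : Matrix (Fin d) (Fin d) ℝ → ℝ) (hg : ∀ X Y, g (X * Y) ≤ g X * g Y) (m n : ℕ) :
    ∑ x : Fin (m + n) → Fin M, g (wordProd A x) ≤
      (∑ x : Fin m → Fin M, g (wordProd A x)) * ∑ x : Fin n → Fin M, g (wordProd A x) := by
  rw [← Equiv.sum_comp (Fin.appendEquiv m n), Fintype.sum_prod_type, Finset.sum_mul_sum]
  refine Finset.sum_le_sum fun x _ => Finset.sum_le_sum fun y _ => ?_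
  have : (Fin.appendEquiv m n) (x, y) = Fin.append x y := rfl
  rw [this, aux_wordProd_append, mul_comm (g _)]
  exact hg _ _

lemma aux_iInf {u : ℕ → ℝ} (hu : Subadditive u) {L : ℝ}
    (hL : Tendsto (fun n => u n / n) atTop (𝓝 L)) :
    (⨅ n : ℕ, ((u (n + 1) / (n + 1) : ℝ) : EReal)) = (L : EReal) := by
  have hb := hL.bddBelow_range
  have hlim : hu.lim = L := tendsto_nhds_unique (hu.tendsto_lim hb) hL
  apply le_antisymm
  · have h1 : Tendsto (fun n : ℕ => ((u (n + 1) / (n + 1) : ℝ) : EReal)) atTop (𝓝 (L : EReal)) := by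
      have := (tendsto_add_atTop_iff_nat 1).2 hL
      refine (continuous_coe_real_ereal.tendsto L).comp ?_
      simpa using this
    exact ge_of_tendsto' h1 fun n => iInf_le _ n
  · refine le_iInf fun n => ?_
    have := hu.lim_le_div hb (Nat.succ_ne_zero n)
    rw [hlim] at this
    push_cast at this
    exact_mod_cast this

lemma aux_bounds {M d : ℕ} (hd : 2 ≤ d)
    (A : Fin M → Matrix (Fin d) (Fin d) ℝ) (hA : IsIrredTuple A)
    (lam : ℝ)
    (h : ∀ n : ℕ, 0 < n → ∀ x : Fin n → Fin M,
      specRad (wordProd A x) = 0 ∨ specRad (wordProd A x) = Real.exp (lam * n)) :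
    (∃ C : ℝ, 0 < C ∧ ∀ n : ℕ, 0 < n → ∀ x : Fin n → Fin M,
      opNorm (wordProd A x) ≤ C * Real.exp (lam * n) ∧
      (wordProd A x ≠ 0 → C⁻¹ * Real.exp (lam * n) ≤ opNorm (wordProd A x))) ∧
    ∀ n : ℕ, ∃ x : Fin n → Fin M, wordProd A x ≠ 0 := by
  let S : Set (Matrix (Fin d) (Fin d) ℝ) :=
    {Y | ∃ n : ℕ, 0 < n ∧ ∃ x : Fin n → Fin M, Y = Real.exp (-(lam * n)) • wordProd A x}
  have hmul : ∀ X ∈ S, ∀ Y ∈ S, X * Y ∈ S := by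
    rintro _ ⟨m, hm, x, rfl⟩ _ ⟨n, hn, y, rfl⟩
    refine ⟨n + m, by omega, Fin.append y x, ?_⟩
    rw [aux_wordProd_append, smul_mul_smul_comm, ← Real.exp_add]
    congr 2
    push_cast; ring
  have hgen : ∀ i, Real.exp (-lam) • A i ∈ S :=
    fun i => ⟨1, one_pos, fun _ => i, by simp [wordProd]⟩
  have hirr : ∀ U : Submodule ℝ (Fin d → ℝ),
      (∀ Y ∈ S, U.map Y.mulVecLin ≤ U) → U = ⊥ ∨ U = ⊤ := by
    intro U hU
    by_contra! hcon
    refine hA ⟨U, fun i => ?_, hcon.1, hcon.2⟩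
    rintro _ ⟨u, hu, rfl⟩
    have h1 : (Real.exp (-lam) • A i) *ᵥ u ∈ U := hU _ (hgen i) ⟨u, hu, rfl⟩
    rw [Matrix.smul_mulVec] at h1
    exact (U.smul_mem_iff (Real.exp_pos _).ne').1 h1
  have htrle : ∀ X ∈ S, |X.trace| ≤ d := by
    rintro _ ⟨n, hn, x, rfl⟩
    have h1 := aux_trace_le (wordProd A x)
    have h2 : specRad (wordProd A x) ≤ Real.exp (lam * n) := by
      rcases h n hn x with h | h <;> rw [h]
      positivity
    rw [Matrix.trace_smul, smul_eq_mul, abs_mul, abs_of_pos (Real.exp_pos _), Real.exp_neg,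
      inv_mul_le_iff₀ (Real.exp_pos _), mul_comm]
    exact h1.trans (by gcongr)
  have htr1 : ∀ X ∈ S, X.trace ≠ 0 → 1 ≤ ‖X‖ := by
    rintro _ ⟨n, hn, x, rfl⟩ hX
    have h1 := aux_trace_le (wordProd A x)
    have h2 := aux_specRad_le (wordProd A x)
    rcases h n hn x with h | h
    · rw [h, mul_zero] at h1
      exact absurd (by rw [Matrix.trace_smul, abs_nonpos_iff.1 h1, smul_zero]) hX
    · rw [h] at h2
      rw [norm_smul, Real.norm_eq_abs, abs_of_pos (Real.exp_pos _), Real.exp_neg,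
        ← div_eq_inv_mul, le_div_iff₀ (Real.exp_pos _), one_mul]
      exact h2
  obtain ⟨C, hC, hb⟩ := aux_bdd S hmul hirr d htrle htr1
  refine ⟨⟨C, hC, fun n hn x => ?_⟩, ?_⟩
  · have h1 := hb _ ⟨n, hn, x, rfl⟩
    rw [norm_smul, Real.norm_eq_abs, abs_of_pos (Real.exp_pos _), Real.exp_neg,
        ← div_eq_inv_mul, le_div_iff₀ (Real.exp_pos _), div_le_iff₀ (Real.exp_pos _)] at h1
    refine ⟨h1.1, fun hne => h1.2 ?_⟩
    exact smul_ne_zero (inv_ne_zero (Real.exp_pos _).ne') hne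
  · -- some generator is nonzero
    obtain ⟨i, hi⟩ : ∃ i, A i ≠ 0 := by
      by_contra! hcon
      have : Nonempty (Fin d) := ⟨⟨0, by omega⟩⟩
      let e : Fin d → ℝ := Pi.single ⟨0, by omega⟩ 1
      refine hA ⟨Submodule.span ℝ {e}, fun i => ?_, ?_, ?_⟩
      · rintro _ ⟨u, -, rfl⟩
        simp [hcon i]
      · simp [e]
      · intro htop
        have h1 := finrank_span_singleton (K := ℝ) (v := e) (by simp [e])
        rw [htop, finrank_top] at h1
        simp at h1
        omega
    have hX : Real.exp (-lam) • A i ≠ 0 := smul_ne_zero (Real.exp_pos _).ne' hi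
    obtain ⟨Y, hY, htr⟩ : ∃ Y ∈ S, (Real.exp (-lam) • A i * Y).trace ≠ 0 := by
      by_contra! hcon
      exact hX (aux_nondeg S hmul hirr _ (Submodule.subset_span (hgen i)) hcon)
    obtain ⟨n, hn, x, hx⟩ := hmul _ (hgen i) _ hY
    rw [hx, Matrix.trace_smul] at htr
    have htr' : (wordProd A x).trace ≠ 0 := fun h => htr (by rw [h, smul_zero])
    have hρ : 0 < specRad (wordProd A x) := by
      have h1 := aux_trace_le (wordProd A x)
      have h2 := abs_pos.2 htr'
      rcases h n hn x with h | h
      · rw [h, mul_zero] at h1; linarith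
      · rw [h]; positivity
    have hpow : ∀ k : ℕ, wordProd A x ^ (k + 1) ≠ 0 := by
      intro k hk
      have : specRad (wordProd A x) ≤ _ := ciInf_le ⟨0, by
        rintro _ ⟨k, rfl⟩; exact Real.rpow_nonneg (norm_nonneg _) _⟩ k
      simp only [hk] at this
      rw [aux_opNorm, norm_zero, Real.zero_rpow (by positivity)] at this
      linarith
    have hword : ∀ k : ℕ, ∃ y : Fin (n * k) → Fin M, wordProd A y = wordProd A x ^ k := by
      intro k
      induction k with
      | zero => exact ⟨fun i => x ⟨0, hn⟩, by simp [wordProd]⟩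
      | succ k ih =>
        obtain ⟨y, hy⟩ := ih
        exact ⟨Fin.append y x, by rw [pow_succ', ← hy]; exact aux_wordProd_append A y x⟩
    intro k
    obtain ⟨y, hy⟩ := hword (k + 1)
    obtain ⟨r, hr⟩ : ∃ r, n * (k + 1) = k + r := Nat.exists_eq_add_of_le (by nlinarith)
    have key : ∀ (N : ℕ) (y : Fin N → Fin M), N = k + r → wordProd A y ≠ 0 →
        ∃ x : Fin k → Fin M, wordProd A x ≠ 0 := by
      rintro _ y rfl hy
      obtain ⟨⟨y1, y2⟩, hyy⟩ := (Fin.appendEquiv k r).surjective y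
      refine ⟨y1, fun h0 => hy ?_⟩
      rw [← hyy]
      exact (aux_wordProd_append A y1 y2).trans (by rw [h0, mul_zero])
    exact key _ y hr (by rw [hy]; exact hpow k)

/-- if every product has spectral radius `0` or `e^{λn}`, then the pressure is an
affine function of `s` (Theorem 4.2, (ii) ⟹ (iii)). -/
theorem stmt_12 {M d : ℕ} (hM : 2 ≤ M) (hd : 2 ≤ d)
    (A : Fin M → Matrix (Fin d) (Fin d) ℝ) (hA : IsIrredTuple A)
    (lam : ℝ)
    (h : ∀ n : ℕ, 0 < n → ∀ x : Fin n → Fin M,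
      specRad (wordProd A x) = 0 ∨ specRad (wordProd A x) = Real.exp (lam * n)) :
    ∃ a b : ℝ, 0 ≤ a ∧ ∀ s : ℝ, 0 < s → pressure A s = ((a + b * s : ℝ) : EReal) := by
  obtain ⟨⟨C, hC, hb⟩, hne⟩ := aux_bounds hd A hA lam h
  classical
  let g : Matrix (Fin d) (Fin d) ℝ → ℝ := fun X => if X = 0 then 0 else 1
  let N : ℕ → ℝ := fun n => ∑ x : Fin n → Fin M, g (wordProd A x)
  have hg0 : ∀ X, 0 ≤ g X := fun X => by simp only [g]; split_ifs <;> norm_num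
  have hgm : ∀ X Y, g (X * Y) ≤ g X * g Y := by
    intro X Y
    by_cases hX : X = 0
    · simp [g, hX]
    by_cases hY : Y = 0
    · simp [g, hY]
    simp only [g, hX, hY, if_false]
    split_ifs <;> norm_num
  have hN1 : ∀ n, 1 ≤ N n := by
    intro n
    obtain ⟨x, hx⟩ := hne n
    have : g (wordProd A x) = 1 := by simp [g, hx]
    rw [← this]
    exact Finset.single_le_sum (f := fun x => g (wordProd A x)) (fun y _ => hg0 _) (Finset.mem_univ x)
  have hNpos : ∀ n, 0 < N n := fun n => one_pos.trans_le (hN1 n)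
  have hsubN : Subadditive (fun n => Real.log (N n)) := by
    intro m n
    rw [← Real.log_mul (hNpos m).ne' (hNpos n).ne']
    exact Real.log_le_log (hNpos _) (aux_submul A g hgm m n)
  have hquot : ∀ n : ℕ, 0 ≤ Real.log (N n) / n := fun n =>
    div_nonneg (Real.log_nonneg (hN1 n)) (Nat.cast_nonneg n)
  have hbN : BddBelow (Set.range fun n : ℕ => Real.log (N n) / n) :=
    ⟨0, by rintro _ ⟨n, rfl⟩; exact hquot n⟩
  have htN := hsubN.tendsto_lim hbN
  refine ⟨hsubN.lim, lam, ge_of_tendsto' htN hquot, fun s hs => ?_⟩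
  let F : ℕ → ℝ := fun n => ∑ x : Fin n → Fin M, opNorm (wordProd A x) ^ s
  have hF1 : ∀ n : ℕ, 0 < n → N n * (C⁻¹ * Real.exp (lam * n)) ^ s ≤ F n := by
    intro n hn
    simp only [N, F]
    rw [Finset.sum_mul]
    refine Finset.sum_le_sum fun x _ => ?_
    by_cases hx : wordProd A x = 0
    · simp only [g, hx, if_true, zero_mul]
      exact Real.rpow_nonneg (norm_nonneg _) _
    · simp only [g, hx, if_false, one_mul]
      exact Real.rpow_le_rpow (by positivity) ((hb n hn x).2 hx) hs.le
  have hF2 : ∀ n : ℕ, 0 < n → F n ≤ N n * (C * Real.exp (lam * n)) ^ s := by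
    intro n hn
    simp only [N, F]
    rw [Finset.sum_mul]
    refine Finset.sum_le_sum fun x _ => ?_
    by_cases hx : wordProd A x = 0
    · simp only [g, hx, if_true, zero_mul]
      rw [aux_opNorm, norm_zero, Real.zero_rpow hs.ne']
    · simp only [g, hx, if_false, one_mul]
      exact Real.rpow_le_rpow (norm_nonneg _) (hb n hn x).1 hs.le
  have hFpos : ∀ n, 0 < F n := by
    intro n
    obtain ⟨x, hx⟩ := hne n
    refine Finset.sum_pos' (fun y _ => Real.rpow_nonneg (norm_nonneg _) _) ⟨x, Finset.mem_univ x, ?_⟩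
    exact Real.rpow_pos_of_pos (by rw [aux_opNorm]; exact norm_pos_iff.2 hx) _
  have hsubF : Subadditive (fun n => Real.log (F n)) := by
    intro m n
    rw [← Real.log_mul (hFpos m).ne' (hFpos n).ne']
    refine Real.log_le_log (hFpos _) (aux_submul A (fun X => opNorm X ^ s) (fun X Y => ?_) m n)
    simp only [aux_opNorm]
    rw [← Real.mul_rpow (norm_nonneg _) (norm_nonneg _)]
    refine Real.rpow_le_rpow (norm_nonneg _) ?_ hs.le
    exact norm_mul_le X Y
  have hlog : ∀ (n : ℕ) (c : ℝ), 0 < c → Real.log (N n * (c * Real.exp (lam * n)) ^ s) =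
      Real.log (N n) + s * Real.log c + lam * s * n := by
    intro n c hc
    rw [Real.log_mul (hNpos n).ne' (by positivity), Real.log_rpow (by positivity),
      Real.log_mul hc.ne' (Real.exp_pos _).ne', Real.log_exp]
    ring
  have hlimc : ∀ c : ℝ, 0 < c → Tendsto (fun n : ℕ =>
      Real.log (N n * (c * Real.exp (lam * n)) ^ s) / n) atTop (𝓝 (hsubN.lim + lam * s)) := by
    intro c hc
    have h1 : Tendsto (fun n : ℕ => s * Real.log c / n) atTop (𝓝 0) :=
      tendsto_const_div_atTop_nhds_zero_nat _
    have h2 := (htN.add h1).add_const (lam * s)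
    rw [add_zero] at h2
    refine h2.congr' ?_
    filter_upwards [eventually_gt_atTop 0] with n hn
    have : (n : ℝ) ≠ 0 := by positivity
    rw [hlog n c hc]
    field_simp
  have htF : Tendsto (fun n : ℕ => Real.log (F n) / n) atTop (𝓝 (hsubN.lim + lam * s)) := by
    refine tendsto_of_tendsto_of_tendsto_of_le_of_le' (hlimc C⁻¹ (by positivity)) (hlimc C hC) ?_ ?_
    · filter_upwards [eventually_gt_atTop 0] with n hn
      have := hNpos n
      exact div_le_div_of_nonneg_right (Real.log_le_log (by positivity) (hF1 n hn)) (by positivity)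
    · filter_upwards [eventually_gt_atTop 0] with n hn
      exact div_le_div_of_nonneg_right (Real.log_le_log (hFpos n) (hF2 n hn)) (by positivity)
  rw [← aux_iInf hsubF htF]
  unfold pressure
  refine iInf_congr fun n => ?_
  rw [if_neg (hFpos (n + 1)).ne']
end

section
/- Let M ≥ 2, d ≥ 1 and let A = (A_1,…,A_M) be an irreducible tuple of d×d real matrices. Then there exists a symmetric positive definite d×d real matrix Q such that Σ_{i=1}^M A_i^T Q A_i = e^{P(A,2)} Q, and Q is unique up to multiplication by a positive scalar: if Q' is any nonzero positive semidefinite d×d real matrix with Σ_{i=1}^M A_i^T Q' A_i = e^{P(A,2)} Q', then Q' = cQ for some c > 0. The same statement holds with A_i^T Q A_i replaced by A_i Q A_i^T throughout. -/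
open MeasureTheory Filter Topology Matrix

/-- `e^{P(A,s)}`, with the convention `e^{-∞} = 0`. -/
noncomputable def expPressure {M d : ℕ} (A : Fin M → Matrix (Fin d) (Fin d) ℝ) (s : ℝ) : ℝ :=
  if pressure A s = ⊥ then 0 else Real.exp (pressure A s).toReal

/-! ### Helper material -/

/-- The transfer operator as a linear map. -/
noncomputable def kusL {M d : ℕ} (A : Fin M → Matrix (Fin d) (Fin d) ℝ) :
    Module.End ℝ (Matrix (Fin d) (Fin d) ℝ) where
  toFun Q := ∑ i, (A i)ᵀ * Q * A i
  map_add' X Y := by simp [Matrix.mul_add, Matrix.add_mul, Finset.sum_add_distrib]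
  map_smul' c X := by simp [Finset.smul_sum]

theorem kusL_apply {M d : ℕ} (A : Fin M → Matrix (Fin d) (Fin d) ℝ)
    (Q : Matrix (Fin d) (Fin d) ℝ) : kusL A Q = ∑ i, (A i)ᵀ * Q * A i := rfl

theorem psd_nonneg {d : ℕ} {Q : Matrix (Fin d) (Fin d) ℝ} (h : Q.PosSemidef) (x : Fin d → ℝ) :
    0 ≤ x ⬝ᵥ Q *ᵥ x := by
  simpa using h.dotProduct_mulVec_nonneg x

theorem pd_pos {d : ℕ} {Q : Matrix (Fin d) (Fin d) ℝ} (h : Q.PosDef) {x : Fin d → ℝ}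
    (hx : x ≠ 0) : 0 < x ⬝ᵥ Q *ᵥ x := by
  simpa using h.dotProduct_mulVec_pos hx

theorem psd_of {d : ℕ} {Q : Matrix (Fin d) (Fin d) ℝ} (h : Q.IsHermitian)
    (h2 : ∀ x : Fin d → ℝ, 0 ≤ x ⬝ᵥ Q *ᵥ x) : Q.PosSemidef :=
  Matrix.PosSemidef.of_dotProduct_mulVec_nonneg h (fun x => by simpa using h2 x)

theorem pd_of {d : ℕ} {Q : Matrix (Fin d) (Fin d) ℝ} (h : Q.IsHermitian)
    (h2 : ∀ x : Fin d → ℝ, x ≠ 0 → 0 < x ⬝ᵥ Q *ᵥ x) : Q.PosDef :=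
  Matrix.PosDef.of_dotProduct_mulVec_pos h (fun {x} hx => by simpa using h2 x hx)

theorem psd_conj {d : ℕ} {Q : Matrix (Fin d) (Fin d) ℝ} (h : Q.PosSemidef)
    (B : Matrix (Fin d) (Fin d) ℝ) : (Bᵀ * Q * B).PosSemidef := by
  have := h.conjTranspose_mul_mul_same B
  rwa [Matrix.conjTranspose_eq_transpose_of_trivial] at this

theorem kusL_psd {M d : ℕ} (A : Fin M → Matrix (Fin d) (Fin d) ℝ)
    {Q : Matrix (Fin d) (Fin d) ℝ} (h : Q.PosSemidef) : (kusL A Q).PosSemidef := by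
  rw [kusL_apply]
  exact Matrix.posSemidef_sum _ (fun i _ => psd_conj h (A i))

theorem kusT_psd {M d : ℕ} (A : Fin M → Matrix (Fin d) (Fin d) ℝ)
    {Q : Matrix (Fin d) (Fin d) ℝ} (h : Q.PosSemidef) (n : ℕ) :
    (((1 + kusL A) ^ n) Q).PosSemidef := by
  induction n with
  | zero => simpa using h
  | succ n ih =>
    rw [pow_succ', Module.End.mul_apply]
    simpa using ih.add (kusL_psd A ih)

theorem kusT_trace {M d : ℕ} (A : Fin M → Matrix (Fin d) (Fin d) ℝ)
    {Q : Matrix (Fin d) (Fin d) ℝ} (h : Q.PosSemidef) (n : ℕ) :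
    Q.trace ≤ (((1 + kusL A) ^ n) Q).trace := by
  induction n with
  | zero => simp
  | succ n ih =>
    rw [pow_succ', Module.End.mul_apply]
    have h1 := (kusL_psd A (kusT_psd A h n)).trace_nonneg
    have h2 : ((1 + kusL A) (((1 + kusL A) ^ n) Q)).trace =
      (((1 + kusL A) ^ n) Q).trace + (kusL A (((1 + kusL A) ^ n) Q)).trace := by
      simp
    linarith

theorem trace_pos_of {d : ℕ} {Q : Matrix (Fin d) (Fin d) ℝ} (h : Q.PosSemidef) (h0 : Q ≠ 0) :
    0 < Q.trace :=
  lt_of_le_of_ne h.trace_nonneg (fun e => h0 (h.trace_eq_zero_iff.1 e.symm))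

/-- the quadratic form of the transfer operator -/
theorem kusL_qf {M d : ℕ} (A : Fin M → Matrix (Fin d) (Fin d) ℝ)
    (Q : Matrix (Fin d) (Fin d) ℝ) (x : Fin d → ℝ) :
    x ⬝ᵥ (kusL A Q) *ᵥ x = ∑ i, (A i *ᵥ x) ⬝ᵥ Q *ᵥ (A i *ᵥ x) := by
  rw [kusL_apply, Matrix.sum_mulVec, dotProduct_sum]
  refine Finset.sum_congr rfl fun i _ => ?_
  rw [← Matrix.mulVec_mulVec, ← Matrix.mulVec_mulVec, Matrix.dotProduct_mulVec,
    Matrix.vecMul_transpose]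

/-- Strong positivity. -/
theorem kusT_posDef {M d : ℕ} (A : Fin M → Matrix (Fin d) (Fin d) ℝ) (hA : IsIrredTuple A)
    {R : Matrix (Fin d) (Fin d) ℝ} (h : R.PosSemidef) (h0 : R ≠ 0) :
    ∃ n : ℕ, (((1 + kusL A) ^ n) R).PosDef := by
  set S : ℕ → Matrix (Fin d) (Fin d) ℝ := fun n => ((1 + kusL A) ^ n) R with hS
  have hSp : ∀ n, (S n).PosSemidef := fun n => kusT_psd A h n
  have hSs : ∀ n, S (n+1) = S n + kusL A (S n) := by
    intro n
    simp only [hS]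
    rw [pow_succ', Module.End.mul_apply]
    simp
  have key : ∀ n x, S (n+1) *ᵥ x = 0 → S n *ᵥ x = 0 ∧ ∀ i, S n *ᵥ (A i *ᵥ x) = 0 := by
    intro n x hx
    have e : x ⬝ᵥ S (n+1) *ᵥ x = 0 := by rw [hx]; simp
    rw [hSs, Matrix.add_mulVec, dotProduct_add, kusL_qf] at e
    have n1 := psd_nonneg (hSp n) x
    have n2 : ∀ i ∈ Finset.univ, 0 ≤ (A i *ᵥ x) ⬝ᵥ S n *ᵥ (A i *ᵥ x) :=
      fun i _ => psd_nonneg (hSp n) _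
    have n3 := Finset.sum_nonneg n2
    have e1 : x ⬝ᵥ S n *ᵥ x = 0 := by linarith
    have e2 : ∑ i, (A i *ᵥ x) ⬝ᵥ S n *ᵥ (A i *ᵥ x) = 0 := by linarith
    refine ⟨((hSp n).dotProduct_mulVec_zero_iff x).1 (by simpa using e1), fun i => ?_⟩
    have := (Finset.sum_eq_zero_iff_of_nonneg n2).1 e2 i (Finset.mem_univ i)
    exact ((hSp n).dotProduct_mulVec_zero_iff _).1 (by simpa using this)
  have hanti : Antitone (fun n => LinearMap.ker (S n).mulVecLin) := by
    refine antitone_nat_of_succ_le fun n x hx => ?_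
    simp only [LinearMap.mem_ker, Matrix.mulVecLin_apply] at hx ⊢
    exact (key n x hx).1
  obtain ⟨n, hn⟩ := IsArtinian.monotone_stabilizes
    (R := ℝ) (M := Fin d → ℝ) ⟨fun n => OrderDual.toDual (LinearMap.ker (S n).mulVecLin), hanti⟩
  have hn1 : LinearMap.ker (S n).mulVecLin = LinearMap.ker (S (n+1)).mulVecLin :=
    hn (n+1) (Nat.le_succ n)
  refine ⟨n, ?_⟩
  have hbot : LinearMap.ker (S n).mulVecLin = ⊥ := by
    by_contra hne
    refine hA ⟨LinearMap.ker (S n).mulVecLin, fun i => ?_, hne, fun htop => ?_⟩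
    · rw [Submodule.map_le_iff_le_comap]
      intro x hx
      rw [hn1] at hx
      simp only [LinearMap.mem_ker, Matrix.mulVecLin_apply, Submodule.mem_comap] at hx ⊢
      exact (key n x hx).2 i
    · have hz : S n = 0 := by
        rw [LinearMap.ker_eq_top] at htop
        exact Matrix.ext_of_mulVec_single fun i => by
          rw [← Matrix.mulVecLin_apply, htop, Matrix.zero_mulVec]; rfl
      have h1 := kusT_trace A h n
      have h2 := trace_pos_of h h0
      have h3 : ((1 + kusL A) ^ n) R = 0 := hz
      rw [h3] at h1
      simp at h1
      linarith
  refine pd_of (hSp n).1 fun x hx => ?_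
  refine lt_of_le_of_ne (psd_nonneg (hSp n) x) fun e => hx ?_
  have : x ∈ LinearMap.ker (S n).mulVecLin := by
    rw [LinearMap.mem_ker, Matrix.mulVecLin_apply]
    exact ((hSp n).dotProduct_mulVec_zero_iff x).1 (by simpa using e.symm)
  rw [hbot] at this
  simpa using this

/-- Perturbation of a positive definite matrix. -/
theorem pd_pert {d : ℕ} {R Q : Matrix (Fin d) (Fin d) ℝ} (hR : R.PosDef) (hQ : Q.IsHermitian) :
    ∃ ε : ℝ, 0 < ε ∧ (R - ε • Q).PosSemidef := by
  have hherm : ∀ ε : ℝ, (R - ε • Q).IsHermitian := by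
    intro ε
    refine hR.1.sub ?_
    unfold Matrix.IsHermitian at *
    rw [Matrix.conjTranspose_smul, hQ]; simp
  have hK : IsCompact (Metric.sphere (0 : Fin d → ℝ) 1) := isCompact_sphere _ _
  have hc : ∀ X : Matrix (Fin d) (Fin d) ℝ, Continuous fun x : Fin d → ℝ => x ⬝ᵥ X *ᵥ x := by
    intro X
    fun_prop
  by_cases hne : (Metric.sphere (0 : Fin d → ℝ) 1).Nonempty
  · obtain ⟨x0, hx0, hmin⟩ := hK.exists_isMinOn hne (hc R).continuousOn
    obtain ⟨x1, hx1, hmax⟩ := hK.exists_isMaxOn hne (hc Q).continuousOn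
    have hx00 : x0 ≠ 0 := by
      rintro rfl
      simp at hx0
    have hcpos := pd_pos hR hx00
    set c := x0 ⬝ᵥ R *ᵥ x0
    set C := x1 ⬝ᵥ Q *ᵥ x1
    have hCp : 0 < |C| + 1 := by positivity
    refine ⟨c / (|C| + 1), by positivity, psd_of (hherm _) fun x => ?_⟩
    by_cases hx : x = 0
    · simp [hx]
    have hxn : ‖x‖ ≠ 0 := by simpa using hx
    set y : Fin d → ℝ := ‖x‖⁻¹ • x with hy
    have hys : y ∈ Metric.sphere (0 : Fin d → ℝ) 1 := by
      simp [hy, norm_smul, hxn]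
    have hxy : x = ‖x‖ • y := by
      rw [hy, smul_smul, mul_inv_cancel₀ hxn, one_smul]
    have a1 : c ≤ y ⬝ᵥ R *ᵥ y := hmin hys
    have a2 : y ⬝ᵥ Q *ᵥ y ≤ C := hmax hys
    have a3 : 0 ≤ y ⬝ᵥ (R - (c / (|C| + 1)) • Q) *ᵥ y := by
      rw [Matrix.sub_mulVec, dotProduct_sub, Matrix.smul_mulVec, dotProduct_smul, smul_eq_mul]
      have b1 : c / (|C| + 1) * (y ⬝ᵥ Q *ᵥ y) ≤ c / (|C| + 1) * (|C| + 1) := by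
        apply mul_le_mul_of_nonneg_left _ (by positivity)
        linarith [le_abs_self C]
      rw [div_mul_cancel₀ _ hCp.ne'] at b1
      linarith
    rw [hxy, Matrix.mulVec_smul, smul_dotProduct, dotProduct_smul, smul_eq_mul, smul_eq_mul]
    have := norm_nonneg x
    positivity
  · refine ⟨1, one_pos, psd_of (hherm _) fun x => ?_⟩
    have hx : x = 0 := by
      by_contra hx
      have hxn : ‖x‖ ≠ 0 := by simpa using hx
      exact hne ⟨‖x‖⁻¹ • x, by simp [norm_smul, hxn]⟩
    simp [hx]

theorem psd_closed (d : ℕ) : IsClosed {Q : Matrix (Fin d) (Fin d) ℝ | Q.PosSemidef} := by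
  have : {Q : Matrix (Fin d) (Fin d) ℝ | Q.PosSemidef} =
      {Q | Qᵀ = Q} ∩ ⋂ x : Fin d → ℝ, {Q | 0 ≤ x ⬝ᵥ Q *ᵥ x} := by
    ext Q
    simp only [Set.mem_ofPred_eq, Set.mem_inter_iff, Set.mem_iInter]
    constructor
    · intro h
      exact ⟨by simpa [Matrix.IsHermitian] using h.1, psd_nonneg h⟩
    · rintro ⟨h1, h2⟩
      exact psd_of (by simpa [Matrix.IsHermitian] using h1) h2
  rw [this]
  refine IsClosed.inter (isClosed_eq (by fun_prop) continuous_id) (isClosed_iInter fun x => ?_)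
  exact isClosed_le continuous_const (by fun_prop)

theorem kusL_cont {M d : ℕ} (A : Fin M → Matrix (Fin d) (Fin d) ℝ) :
    Continuous fun Q => kusL A Q := by
  simp only [kusL_apply]
  fun_prop

theorem psd_sqrt {d : ℕ} {Q : Matrix (Fin d) (Fin d) ℝ} (h : Q.PosSemidef) :
    ∃ B : Matrix (Fin d) (Fin d) ℝ, Q = Bᵀ * B := by
  open scoped MatrixOrder in
  obtain ⟨B, hB⟩ := CStarAlgebra.nonneg_iff_eq_star_mul_self.1 h.nonneg
  refine ⟨B, ?_⟩
  rwa [Matrix.star_eq_conjTranspose, Matrix.conjTranspose_eq_transpose_of_trivial] at hB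

/-- The Collatz–Wielandt maximum is attained. -/
theorem cw_max {M d : ℕ} (hd : 1 ≤ d) (A : Fin M → Matrix (Fin d) (Fin d) ℝ) :
    ∃ r : ℝ, 0 ≤ r ∧
      (∃ Q : Matrix (Fin d) (Fin d) ℝ, Q.PosSemidef ∧ Q ≠ 0 ∧ (kusL A Q - r • Q).PosSemidef) ∧
      ∀ r' : ℝ, ∀ Q : Matrix (Fin d) (Fin d) ℝ, Q.PosSemidef → Q ≠ 0 →
        (kusL A Q - r' • Q).PosSemidef → r' ≤ r := by
  set K0 : Set (Matrix (Fin d) (Fin d) ℝ) :=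
    Set.pi Set.univ fun _ => Set.pi Set.univ fun _ => Set.Icc (-1 : ℝ) 1 with hK0
  have hK0c : IsCompact K0 := isCompact_univ_pi fun _ => isCompact_univ_pi fun _ => isCompact_Icc
  have hcL : Continuous fun B : Matrix (Fin d) (Fin d) ℝ => kusL A (Bᵀ * B) :=
    (kusL_cont A).comp (by fun_prop)
  have hct : Continuous fun B : Matrix (Fin d) (Fin d) ℝ => (kusL A (Bᵀ * B)).trace :=
    hcL.matrix_trace
  obtain ⟨C, hC⟩ := hK0c.bddAbove_image hct.continuousOn
  set K : Set (ℝ × Matrix (Fin d) (Fin d) ℝ) := (Set.Icc 0 C ×ˢ K0) ∩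
    ({p | (p.2ᵀ * p.2).trace = 1} ∩ {p | (kusL A (p.2ᵀ * p.2) - p.1 • (p.2ᵀ * p.2)).PosSemidef})
    with hK
  have hKc : IsCompact K := by
    refine (isCompact_Icc.prod hK0c).inter_right (IsClosed.inter ?_ ?_)
    · exact isClosed_eq (Continuous.matrix_trace (by fun_prop)) continuous_const
    · refine (psd_closed d).preimage (f := fun p : ℝ × Matrix (Fin d) (Fin d) ℝ =>
        kusL A (p.2ᵀ * p.2) - p.1 • (p.2ᵀ * p.2)) ?_
      exact (hcL.comp continuous_snd).sub (by fun_prop)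
  have mem : ∀ r' : ℝ, 0 ≤ r' → ∀ Q : Matrix (Fin d) (Fin d) ℝ, Q.PosSemidef → Q ≠ 0 →
        (kusL A Q - r' • Q).PosSemidef → ∃ B, (r', B) ∈ K := by
    intro r' hr' Q hQ hQ0 hP
    have ht := trace_pos_of hQ hQ0
    obtain ⟨B, hB⟩ := psd_sqrt (hQ.smul (inv_nonneg.2 ht.le))
    have h1 : (Bᵀ * B).trace = 1 := by
      rw [← hB, Matrix.trace_smul, smul_eq_mul, inv_mul_cancel₀ ht.ne']
    have h2 : (kusL A (Bᵀ * B) - r' • (Bᵀ * B)).PosSemidef := by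
      rw [← hB, map_smul, smul_comm, ← smul_sub]
      exact hP.smul (inv_nonneg.2 ht.le)
    have h3 : B ∈ K0 := by
      intro i _ j _
      have e : (Bᵀ * B).trace = ∑ j, ∑ i, B i j * B i j := by
        simp [Matrix.trace, Matrix.mul_apply]
      have l1 : ∑ i, B i j * B i j ≤ ∑ j, ∑ i, B i j * B i j :=
        Finset.single_le_sum (f := fun j => ∑ i, B i j * B i j)
          (fun j _ => Finset.sum_nonneg fun i _ => mul_self_nonneg _) (Finset.mem_univ j)
      have l2 : B i j * B i j ≤ ∑ i, B i j * B i j :=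
        Finset.single_le_sum (f := fun i => B i j * B i j)
          (fun i _ => mul_self_nonneg _) (Finset.mem_univ i)
      have l3 : B i j ^ 2 ≤ 1 := by nlinarith
      exact abs_le.1 ((sq_le_one_iff_abs_le_one _).1 l3)
    refine ⟨B, ⟨⟨⟨hr', ?_⟩, h3⟩, h1, h2⟩⟩
    have h4 : (kusL A (Bᵀ * B)).trace ≤ C := hC ⟨B, h3, rfl⟩
    have h5 := h2.trace_nonneg
    rw [Matrix.trace_sub, Matrix.trace_smul, h1, smul_eq_mul, mul_one] at h5
    simp only
    linarith
  have h1psd : (1 : Matrix (Fin d) (Fin d) ℝ).PosSemidef := Matrix.PosSemidef.one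
  have : Nonempty (Fin d) := ⟨⟨0, hd⟩⟩
  have hKne : K.Nonempty := by
    obtain ⟨B, hB⟩ := mem 0 le_rfl 1 h1psd one_ne_zero (by simpa using kusL_psd A h1psd)
    exact ⟨_, hB⟩
  obtain ⟨⟨r, B⟩, hp, hmax⟩ := hKc.exists_isMaxOn hKne continuous_fst.continuousOn
  refine ⟨r, hp.1.1.1, ⟨Bᵀ * B, ?_, ?_, hp.2.2⟩, ?_⟩
  · have := Matrix.posSemidef_conjTranspose_mul_self B
    rwa [Matrix.conjTranspose_eq_transpose_of_trivial] at this
  · intro h0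
    have := hp.2.1
    simp only [Set.mem_ofPred_eq] at this
    rw [h0] at this
    simp at this
  · intro r' Q hQ hQ0 hP
    by_cases hr' : 0 ≤ r'
    · obtain ⟨B', hB'⟩ := mem r' hr' Q hQ hQ0 hP
      exact hmax hB'
    · have := hp.1.1.1
      simp only at this
      linarith

theorem kusT_eig {M d : ℕ} (A : Fin M → Matrix (Fin d) (Fin d) ℝ) {r : ℝ}
    {Q : Matrix (Fin d) (Fin d) ℝ} (h : kusL A Q = r • Q) (n : ℕ) :
    ((1 + kusL A) ^ n) Q = (1 + r) ^ n • Q := by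
  induction n with
  | zero => simp
  | succ n ih =>
    rw [pow_succ', Module.End.mul_apply, ih, map_smul]
    simp only [LinearMap.add_apply, Module.End.one_apply, h]
    rw [pow_succ, mul_smul, add_smul, one_smul]

/-- A nonzero positive semidefinite eigenmatrix is positive definite. -/
theorem eig_posDef {M d : ℕ} (A : Fin M → Matrix (Fin d) (Fin d) ℝ) (hA : IsIrredTuple A) {r : ℝ}
    (hr : 0 ≤ r) {Q : Matrix (Fin d) (Fin d) ℝ} (hQ : Q.PosSemidef) (hQ0 : Q ≠ 0)
    (h : kusL A Q = r • Q) : Q.PosDef := by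
  obtain ⟨n, hn⟩ := kusT_posDef A hA hQ hQ0
  rw [kusT_eig A h] at hn
  have hp : 0 < (1 + r) ^ n := by positivity
  have := hn.smul (inv_pos.2 hp)
  rwa [smul_smul, inv_mul_cancel₀ hp.ne', one_smul] at this

theorem exists_eig {M d : ℕ} (hd : 1 ≤ d) (A : Fin M → Matrix (Fin d) (Fin d) ℝ)
    (hA : IsIrredTuple A) :
    ∃ r : ℝ, 0 ≤ r ∧ ∃ Q : Matrix (Fin d) (Fin d) ℝ, Q.PosDef ∧ kusL A Q = r • Q := by
  obtain ⟨r, hr, ⟨Q, hQ, hQ0, hP⟩, hmax⟩ := cw_max hd A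
  have hz : kusL A Q - r • Q = 0 := by
    by_contra hne
    obtain ⟨n, hn⟩ := kusT_posDef A hA hP hne
    have hTQ := kusT_psd A hQ n
    obtain ⟨ε, hε, hpert⟩ := pd_pert hn hTQ.1
    have hTQ0 : ((1 + kusL A) ^ n) Q ≠ 0 := by
      intro h0
      have h1 := kusT_trace A hQ n
      have h2 := trace_pos_of hQ hQ0
      rw [h0] at h1
      simp at h1
      linarith
    have hcomm : ((1 + kusL A) ^ n) (kusL A Q) = kusL A (((1 + kusL A) ^ n) Q) := by
      have : Commute ((1 + kusL A) ^ n) (kusL A) :=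
        ((Commute.one_left _).add_left (Commute.refl _)).pow_left n
      exact congrArg (fun f => f Q) this.eq
    have := hmax (r + ε) _ hTQ hTQ0 (by
      rw [map_sub, map_smul, hcomm] at hpert
      rwa [add_smul, ← sub_sub])
    linarith
  have he : kusL A Q = r • Q := sub_eq_zero.1 hz
  exact ⟨r, hr, Q, eig_posDef A hA hr hQ hQ0 he, he⟩

theorem unique_eig {M d : ℕ} (hd : 1 ≤ d) (A : Fin M → Matrix (Fin d) (Fin d) ℝ)
    (hA : IsIrredTuple A) {r : ℝ} (hr : 0 ≤ r) {Q Q' : Matrix (Fin d) (Fin d) ℝ} (hQ : Q.PosDef)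
    (hL : kusL A Q = r • Q) (hQ' : Q'.PosSemidef) (hQ0' : Q' ≠ 0) (hL' : kusL A Q' = r • Q') :
    ∃ c : ℝ, 0 < c ∧ Q' = c • Q := by
  have : Nonempty (Fin d) := ⟨⟨0, hd⟩⟩
  have ht' := trace_pos_of hQ' hQ0'
  set T : Set ℝ := {t | 0 ≤ t ∧ (Q - t • Q').PosSemidef} with hT
  have hTc : IsClosed T := by
    refine isClosed_Ici.inter ((psd_closed d).preimage (f := fun t : ℝ => Q - t • Q') ?_)
    fun_prop
  have hTne : T.Nonempty := ⟨0, le_rfl, by simpa using hQ.posSemidef⟩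
  have hTb : BddAbove T := by
    refine ⟨Q.trace / Q'.trace, fun t ht => ?_⟩
    have := ht.2.trace_nonneg
    rw [Matrix.trace_sub, Matrix.trace_smul, smul_eq_mul] at this
    rw [le_div_iff₀ ht']
    linarith
  have hmem := hTc.csSup_mem hTne hTb
  set t := sSup T
  have hz : Q - t • Q' = 0 := by
    by_contra hne
    have hpd : (Q - t • Q').PosDef := eig_posDef A hA hr hmem.2 hne (by
      rw [map_sub, map_smul, hL, hL', smul_sub, smul_comm])
    obtain ⟨ε, hε, hpert⟩ := pd_pert hpd hQ'.1
    have : t + ε ∈ T := ⟨by linarith [hmem.1], by rwa [add_smul, ← sub_sub]⟩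
    have := le_csSup hTb this
    linarith
  have he : Q = t • Q' := sub_eq_zero.1 hz
  have htp : 0 < t := by
    refine lt_of_le_of_ne hmem.1 fun h0 => ?_
    have := hQ.trace_pos
    rw [he, ← h0] at this
    simp at this
  exact ⟨t⁻¹, inv_pos.2 htp, by rw [he, smul_smul, inv_mul_cancel₀ htp.ne', one_smul]⟩

theorem irred_transpose {M d : ℕ} (A : Fin M → Matrix (Fin d) (Fin d) ℝ) (hA : IsIrredTuple A) :
    IsIrredTuple (fun i => (A i)ᵀ) := by
  rintro ⟨U, hU, hbot, htop⟩
  let V : Submodule ℝ (Fin d → ℝ) :=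
    { carrier := {v | ∀ u ∈ U, u ⬝ᵥ v = 0}
      add_mem' := fun {a b} ha hb u hu => by rw [dotProduct_add, ha u hu, hb u hu, add_zero]
      zero_mem' := fun u _ => by simp
      smul_mem' := fun c a ha u hu => by rw [dotProduct_smul, ha u hu, smul_zero] }
  refine hA ⟨V, fun i => ?_, ?_, ?_⟩
  · rw [Submodule.map_le_iff_le_comap]
    intro v hv u hu
    have h1 : (A i)ᵀ *ᵥ u ∈ U := hU i ⟨u, hu, rfl⟩
    have h2 := hv _ h1
    rw [Matrix.mulVecLin_apply, Matrix.dotProduct_mulVec, ← Matrix.mulVec_transpose]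
    exact h2
  · obtain ⟨f, hf, hUf⟩ := Submodule.exists_le_ker_of_lt_top U (lt_top_iff_ne_top.2 htop)
    intro hV
    set v : Fin d → ℝ := fun i => f (Pi.single i 1) with hv
    have hfv : ∀ u, f u = u ⬝ᵥ v := by
      intro u
      rw [LinearMap.pi_apply_eq_sum_univ f u]
      simp only [dotProduct, hv, smul_eq_mul]
      refine Finset.sum_congr rfl fun i _ => ?_
      congr 2
      ext j
      simp [Pi.single_apply, eq_comm]
    have hvV : v ∈ V := fun u hu => by
      rw [← hfv]; exact hUf hu
    rw [hV, Submodule.mem_bot] at hvV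
    apply hf
    ext u
    simp [hfv, hvV]
  · intro hV
    apply hbot
    rw [Submodule.eq_bot_iff]
    intro u hu
    have : u ∈ V := by rw [hV]; trivial
    exact dotProduct_self_eq_zero.1 (this u hu)

theorem wordProd_cons {M d n : ℕ} (A : Fin M → Matrix (Fin d) (Fin d) ℝ) (i : Fin M)
    (x : Fin n → Fin M) : wordProd A (Fin.cons i x : Fin (n+1) → Fin M) = wordProd A x * A i := by
  simp [wordProd, List.ofFn_succ]

theorem kusL_pow {M d : ℕ} (A : Fin M → Matrix (Fin d) (Fin d) ℝ) (Q : Matrix (Fin d) (Fin d) ℝ)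
    (n : ℕ) : ((kusL A) ^ n) Q = ∑ x : Fin n → Fin M, (wordProd A x)ᵀ * Q * wordProd A x := by
  induction n with
  | zero => simp [wordProd]
  | succ n ih =>
    rw [pow_succ', Module.End.mul_apply, ih, kusL_apply]
    rw [← (Fin.consEquiv fun _ : Fin (n+1) => Fin M).sum_comp, Fintype.sum_prod_type]
    refine Finset.sum_congr rfl fun i _ => ?_
    rw [Finset.mul_sum, Finset.sum_mul]
    refine Finset.sum_congr rfl fun x _ => ?_
    have : (Fin.consEquiv fun _ : Fin (n+1) => Fin M) (i, x) = Fin.cons i x := rfl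
    rw [this, wordProd_cons, Matrix.transpose_mul]
    simp only [Matrix.mul_assoc]

theorem kusL_pow_eig {M d : ℕ} (A : Fin M → Matrix (Fin d) (Fin d) ℝ) {r : ℝ}
    {Q : Matrix (Fin d) (Fin d) ℝ} (h : kusL A Q = r • Q) (n : ℕ) :
    ((kusL A) ^ n) Q = r ^ n • Q := by
  induction n with
  | zero => simp
  | succ n ih =>
    rw [pow_succ', Module.End.mul_apply, ih, map_smul, h, smul_smul, pow_succ]

theorem opNorm_nonneg' {d : ℕ} (X : Matrix (Fin d) (Fin d) ℝ) : 0 ≤ opNorm X := norm_nonneg _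

theorem opNorm_mul_le' {d : ℕ} (X Y : Matrix (Fin d) (Fin d) ℝ) :
    opNorm (X * Y) ≤ opNorm X * opNorm Y := by
  unfold opNorm
  rw [map_mul]
  exact norm_mul_le _ _

theorem opNorm_transpose' {d : ℕ} (X : Matrix (Fin d) (Fin d) ℝ) : opNorm Xᵀ = opNorm X := by
  have := Matrix.l2_opNorm_conjTranspose X
  rw [Matrix.conjTranspose_eq_transpose_of_trivial] at this
  exact this

theorem opNorm_smul' {d : ℕ} (c : ℝ) (X : Matrix (Fin d) (Fin d) ℝ) :
    opNorm (c • X) = |c| * opNorm X := by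
  unfold opNorm
  rw [map_smul, norm_smul, Real.norm_eq_abs]

theorem opNorm_pos' {d : ℕ} {X : Matrix (Fin d) (Fin d) ℝ} (h : X ≠ 0) : 0 < opNorm X := by
  unfold opNorm
  rw [norm_pos_iff]
  intro h0
  exact h ((map_eq_zero_iff _ (Matrix.toEuclideanCLM (n := Fin d) (𝕜 := ℝ)).injective).1 h0)

theorem opNorm_sum_le' {d : ℕ} {ι : Type*} (s : Finset ι) (f : ι → Matrix (Fin d) (Fin d) ℝ) :
    opNorm (∑ i ∈ s, f i) ≤ ∑ i ∈ s, opNorm (f i) := by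
  unfold opNorm
  rw [map_sum]
  exact norm_sum_le _ _

theorem opNorm_sq_le_trace {d : ℕ} (X : Matrix (Fin d) (Fin d) ℝ) :
    opNorm X ^ 2 ≤ (Xᵀ * X).trace := by
  have e : (Xᵀ * X).trace = ∑ i, ∑ j, X i j ^ 2 := by
    simp only [Matrix.trace, Matrix.diag, Matrix.mul_apply, Matrix.transpose_apply]
    rw [Finset.sum_comm]
    simp only [sq]
  have h0 : 0 ≤ (Xᵀ * X).trace := by rw [e]; positivity
  have : opNorm X ≤ √((Xᵀ * X).trace) := by
    refine ContinuousLinearMap.opNorm_le_bound _ (Real.sqrt_nonneg _) fun v => ?_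
    rw [← Real.sqrt_sq (norm_nonneg v), ← Real.sqrt_mul h0]
    refine Real.le_sqrt_of_sq_le ?_
    rw [EuclideanSpace.norm_sq_eq, EuclideanSpace.norm_sq_eq, e, Finset.sum_mul]
    refine Finset.sum_le_sum fun i _ => ?_
    simp only [Matrix.ofLp_toEuclideanCLM, Real.norm_eq_abs, sq_abs]
    exact Finset.sum_mul_sq_le_sq_mul_sq Finset.univ (fun j => X i j) (fun j => v j)
  calc opNorm X ^ 2 ≤ √((Xᵀ * X).trace) ^ 2 := by
        gcongr
        exact opNorm_nonneg' X
    _ = _ := Real.sq_sqrt h0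

/-- lower bound on the partition sums -/
theorem sum_lower {M d : ℕ} (A : Fin M → Matrix (Fin d) (Fin d) ℝ) {r : ℝ} (hr : 0 ≤ r)
    {Q : Matrix (Fin d) (Fin d) ℝ} (h0 : Q ≠ 0) (h : kusL A Q = r • Q) (n : ℕ) :
    r ^ n ≤ ∑ x : Fin n → Fin M, opNorm (wordProd A x) ^ 2 := by
  have h1 := kusL_pow A Q n
  rw [kusL_pow_eig A h] at h1
  have h2 : r ^ n * opNorm Q ≤ (∑ x : Fin n → Fin M, opNorm (wordProd A x) ^ 2) * opNorm Q := by
    calc r ^ n * opNorm Q = opNorm (r ^ n • Q) := by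
          rw [opNorm_smul', abs_of_nonneg (by positivity)]
      _ ≤ ∑ x : Fin n → Fin M, opNorm ((wordProd A x)ᵀ * Q * wordProd A x) := by
          rw [h1]; exact opNorm_sum_le' _ _
      _ ≤ ∑ x : Fin n → Fin M, opNorm (wordProd A x) ^ 2 * opNorm Q := by
          refine Finset.sum_le_sum fun x _ => ?_
          calc _ ≤ opNorm ((wordProd A x)ᵀ * Q) * opNorm (wordProd A x) := opNorm_mul_le' _ _
            _ ≤ (opNorm (wordProd A x)ᵀ * opNorm Q) * opNorm (wordProd A x) := by
                gcongr
                · exact opNorm_nonneg' _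
                · exact opNorm_mul_le' _ _
            _ = _ := by rw [opNorm_transpose']; ring
      _ = _ := by rw [Finset.sum_mul]
  exact le_of_mul_le_mul_right h2 (opNorm_pos' h0)

/-- upper bound on the partition sums -/
theorem sum_upper {M d : ℕ} (A : Fin M → Matrix (Fin d) (Fin d) ℝ) {r : ℝ}
    {Q : Matrix (Fin d) (Fin d) ℝ} (hd : 1 ≤ d) (hQ : Q.PosDef) (h : kusL A Q = r • Q) :
    ∃ b : ℝ, 0 < b ∧ ∀ n : ℕ, ∑ x : Fin n → Fin M, opNorm (wordProd A x) ^ 2 ≤ b * r ^ n := by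
  have : Nonempty (Fin d) := ⟨⟨0, hd⟩⟩
  obtain ⟨c, hc, hP⟩ := pd_pert hQ (Matrix.isHermitian_one (n := Fin d) (α := ℝ))
  have hQt := hQ.trace_pos
  refine ⟨c⁻¹ * Q.trace, by positivity, fun n => ?_⟩
  have h1 := kusL_pow A Q n
  rw [kusL_pow_eig A h] at h1
  have h2 := congrArg Matrix.trace h1
  rw [Matrix.trace_smul, Matrix.trace_sum, smul_eq_mul] at h2
  have h3 : ∑ x : Fin n → Fin M, c * opNorm (wordProd A x) ^ 2 ≤ r ^ n * Q.trace := by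
    rw [h2]
    refine Finset.sum_le_sum fun x _ => ?_
    have h4 := (psd_conj hP (wordProd A x)).trace_nonneg
    rw [Matrix.mul_sub, Matrix.sub_mul, Matrix.trace_sub, Matrix.mul_smul, Matrix.smul_mul,
      Matrix.mul_one, Matrix.trace_smul, smul_eq_mul] at h4
    have h5 := mul_le_mul_of_nonneg_left (opNorm_sq_le_trace (wordProd A x)) hc.le
    linarith
  rw [← Finset.mul_sum] at h3
  calc _ = c⁻¹ * (c * ∑ x : Fin n → Fin M, opNorm (wordProd A x) ^ 2) := by
        rw [← mul_assoc, inv_mul_cancel₀ hc.ne', one_mul]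
    _ ≤ c⁻¹ * (r ^ n * Q.trace) := by gcongr
    _ = _ := by ring

theorem eig_eq {M d : ℕ} (A : Fin M → Matrix (Fin d) (Fin d) ℝ) {r : ℝ} (hr : 0 ≤ r)
    {Q : Matrix (Fin d) (Fin d) ℝ} (hd : 1 ≤ d) (hQ : Q.PosDef) (h : kusL A Q = r • Q) :
    expPressure A 2 = r := by
  have : Nonempty (Fin d) := ⟨⟨0, hd⟩⟩
  have hQ0 : Q ≠ 0 := by
    rintro rfl
    have := hQ.trace_pos
    simp at this
  obtain ⟨b, hb, hup⟩ := sum_upper A hd hQ h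
  have hlow := sum_lower A hr hQ0 h
  have hS0 : ∀ n, 0 ≤ ∑ x : Fin n → Fin M, opNorm (wordProd A x) ^ 2 := fun n =>
    Finset.sum_nonneg fun x _ => sq_nonneg _
  unfold expPressure
  have hpr : pressure A 2 = ⨅ n : ℕ,
      if (∑ x : Fin (n + 1) → Fin M, opNorm (wordProd A x) ^ 2) = 0 then (⊥ : EReal)
      else ((Real.log (∑ x : Fin (n + 1) → Fin M, opNorm (wordProd A x) ^ 2) / (n + 1) : ℝ)
        : EReal) := by
    simp only [pressure, Real.rpow_two]
  rcases hr.eq_or_lt with rfl | hr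
  · have : pressure A 2 = ⊥ := by
      rw [hpr]
      refine le_bot_iff.1 (iInf_le_of_le 0 ?_)
      have h1 := hup (0+1)
      have h2 : ∑ x : Fin (0 + 1) → Fin M, opNorm (wordProd A x) ^ 2 = 0 :=
        le_antisymm (by simpa using h1) (hS0 _)
      rw [if_pos h2]
    rw [if_pos this]
  · have hpos : ∀ n, 0 < ∑ x : Fin n → Fin M, opNorm (wordProd A x) ^ 2 := fun n =>
      lt_of_lt_of_le (by positivity) (hlow n)
    have hP : pressure A 2 = (Real.log r : ℝ) := by
      rw [hpr]
      apply le_antisymm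
      · have hlim : Tendsto (fun n : ℕ => (Real.log b / ((n : ℝ) + 1) + Real.log r)) atTop
            (𝓝 (Real.log r)) := by
          have h1 : Tendsto (fun n : ℕ => Real.log b / ((n : ℝ) + 1)) atTop (𝓝 0) := by
            have := (tendsto_one_div_add_atTop_nhds_zero_nat (𝕜 := ℝ)).const_mul (Real.log b)
            simpa [div_eq_mul_inv] using this
          simpa using h1.add_const (Real.log r)
        have hlim' := (continuous_coe_real_ereal.tendsto _).comp hlim
        refine ge_of_tendsto' hlim' fun n => iInf_le_of_le n ?_
        rw [if_neg (hpos (n+1)).ne']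
        simp only [Function.comp]
        rw [EReal.coe_le_coe_iff]
        have hn : (0:ℝ) < n + 1 := by positivity
        have h1 := Real.log_le_log (hpos (n+1)) (hup (n+1))
        rw [Real.log_mul hb.ne' (by positivity), Real.log_pow] at h1
        push_cast at h1
        rw [div_le_iff₀ hn, add_mul, div_mul_cancel₀ _ hn.ne']
        linarith
      · refine le_iInf fun n => ?_
        rw [if_neg (hpos (n+1)).ne', EReal.coe_le_coe_iff]
        have hn : (0:ℝ) < n + 1 := by positivity
        have h1 := Real.log_le_log (by positivity) (hlow (n+1))
        rw [Real.log_pow] at h1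
        push_cast at h1
        rw [le_div_iff₀ hn]
        linarith
    rw [hP, if_neg (EReal.coe_ne_bot _), EReal.toReal_coe, Real.exp_log hr]

theorem trace_mul_pos {d : ℕ} (hd : 1 ≤ d) {P Q : Matrix (Fin d) (Fin d) ℝ} (hP : P.PosDef)
    (hQ : Q.PosDef) : 0 < (P * Q).trace := by
  have : Nonempty (Fin d) := ⟨⟨0, hd⟩⟩
  obtain ⟨c, hc, h⟩ := pd_pert hP (Matrix.isHermitian_one (n := Fin d) (α := ℝ))
  obtain ⟨B, hB⟩ := psd_sqrt hQ.posSemidef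
  have h1 := (psd_conj h Bᵀ).trace_nonneg
  rw [Matrix.transpose_transpose, Matrix.trace_mul_cycle, ← hB, Matrix.trace_mul_comm,
    Matrix.sub_mul, Matrix.trace_sub, Matrix.smul_mul, Matrix.one_mul, Matrix.trace_smul,
    smul_eq_mul] at h1
  have := mul_pos hc hQ.trace_pos
  linarith

theorem dual_eig {M d : ℕ} (hd : 1 ≤ d) (A : Fin M → Matrix (Fin d) (Fin d) ℝ) {r s : ℝ}
    {P Q : Matrix (Fin d) (Fin d) ℝ} (hP : P.PosDef) (hQ : Q.PosDef)
    (h1 : kusL A P = r • P) (h2 : kusL (fun i => (A i)ᵀ) Q = s • Q) : s = r := by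
  have hp := trace_mul_pos hd hP hQ
  have e : (kusL A P * Q).trace = (P * kusL (fun i => (A i)ᵀ) Q).trace := by
    rw [kusL_apply, kusL_apply, Finset.sum_mul, Finset.mul_sum, Matrix.trace_sum, Matrix.trace_sum]
    refine Finset.sum_congr rfl fun i _ => ?_
    rw [Matrix.transpose_transpose, Matrix.mul_assoc, Matrix.mul_assoc, Matrix.trace_mul_comm]
    simp only [Matrix.mul_assoc]
  rw [h1, h2, Matrix.smul_mul, Matrix.mul_smul, Matrix.trace_smul, Matrix.trace_smul,
    smul_eq_mul, smul_eq_mul] at e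
  exact (mul_right_cancel₀ hp.ne' e).symm

/-- existence and essential uniqueness of the positive definite eigenmatrices of
the Kusuoka transfer operators `L_A B = Σ A_iᵀ B A_i` and `L̂_A B = Σ A_i B A_iᵀ`, with
eigenvalue `e^{P(A,2)}`. -/
theorem stmt_17 {M d : ℕ} (hM : 2 ≤ M) (hd : 1 ≤ d)
    (A : Fin M → Matrix (Fin d) (Fin d) ℝ) (hA : IsIrredTuple A) :
    (∃ Q : Matrix (Fin d) (Fin d) ℝ, Q.PosDef ∧
      (∑ i, (A i)ᵀ * Q * A i) = expPressure A 2 • Q ∧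
      ∀ Q' : Matrix (Fin d) (Fin d) ℝ, Q'.PosSemidef → Q' ≠ 0 →
        (∑ i, (A i)ᵀ * Q' * A i) = expPressure A 2 • Q' →
        ∃ c : ℝ, 0 < c ∧ Q' = c • Q) ∧
    (∃ Qh : Matrix (Fin d) (Fin d) ℝ, Qh.PosDef ∧
      (∑ i, A i * Qh * (A i)ᵀ) = expPressure A 2 • Qh ∧
      ∀ Q' : Matrix (Fin d) (Fin d) ℝ, Q'.PosSemidef → Q' ≠ 0 →
        (∑ i, A i * Q' * (A i)ᵀ) = expPressure A 2 • Q' →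
        ∃ c : ℝ, 0 < c ∧ Q' = c • Qh) := by
  obtain ⟨r, hr, Q, hQ, hL⟩ := exists_eig hd A hA
  have hA' := irred_transpose A hA
  obtain ⟨s, hs, Qh, hQh, hLh⟩ := exists_eig hd _ hA'
  have hsr : s = r := dual_eig hd A hQ hQh hL hLh
  subst hsr
  rw [eig_eq A hr hd hQ hL]
  refine ⟨⟨Q, hQ, hL, fun Q' h1 h2 h3 => unique_eig hd A hA hr hQ hL h1 h2 h3⟩,
    ⟨Qh, hQh, ?_, fun Q' h1 h2 h3 => unique_eig hd _ hA' hr hQh hLh h1 h2 ?_⟩⟩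
  · simpa [kusL_apply] using hLh
  · simpa [kusL_apply] using h3
end
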